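/- For every ε > 0 the following integral identity holds: 2 ∫_Ω |∇u_ε|² (1 − |u_ε|²) dx = (2/ε²) ∫_Ω |u_ε|² (1 − |u_ε|²)² dx + ∫_Ω |∇(1 − |u_ε|²)|² dx. -/

import Mathlib

open MeasureTheory Filter Topology

noncomputable section

/-- Points of the plane, viewed as the Euclidean space `ℝ²`. -/
abbrev Pt : Type := EuclideanSpace ℝ (Fin 2)

/-- The `i`-th partial derivative of a complex-valued function. -/
def pd (u : Pt → ℂ) (x : Pt) (i : Fin 2) : ℂ :=
  fderiv ℝ u x (EuclideanSpace.single i 1)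

/-- Squared Hilbert–Schmidt norm of the derivative, `|∇u|²`. -/
def gradSq (u : Pt → ℂ) (x : Pt) : ℝ :=
  ∑ i, ‖pd u x i‖ ^ 2

/-- `|∇u − ∇v|²`. -/
def gradDiffSq (u v : Pt → ℂ) (x : Pt) : ℝ :=
  ∑ i, ‖pd u x i - pd v x i‖ ^ 2

/-- Laplacian of a complex-valued function. -/
def lap (u : Pt → ℂ) (x : Pt) : ℂ :=
  ∑ i, fderiv ℝ (fun y => pd u y i) x (EuclideanSpace.single i 1)

/-- The `i`-th partial derivative of a real-valued function. -/
def pdR (f : Pt → ℝ) (x : Pt) (i : Fin 2) : ℝ :=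
  fderiv ℝ f x (EuclideanSpace.single i 1)

/-- `|∇f|²` for a real-valued function `f`. -/
def gradSqR (f : Pt → ℝ) (x : Pt) : ℝ :=
  ∑ i, (pdR f x i) ^ 2

/-- Laplacian of a real-valued function. -/
def lapR (f : Pt → ℝ) (x : Pt) : ℝ :=
  ∑ i, fderiv ℝ (fun y => pdR f y i) x (EuclideanSpace.single i 1)

section IntegrationByParts

variable {E : Type*} [NormedAddCommGroup E] [NormedSpace ℝ E] [MeasurableSpace E] [BorelSpace E]
  {μ : Measure E}

theorem integrable_fderiv_apply_of_hasCompactSupport [IsFiniteMeasureOnCompacts μ]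
    {f : E → ℝ} (hf : ContDiff ℝ 1 f) (hc : HasCompactSupport f) (v : E) : Integrable (fun x => fderiv ℝ f x v) μ :=
  ((hf.continuous_fderiv one_ne_zero).clm_apply continuous_const).integrable_of_hasCompactSupport
    (hc.fderiv_apply ℝ v)

theorem integral_fderiv_apply_eq_zero_of_hasCompactSupport [FiniteDimensional ℝ E] [μ.IsAddHaarMeasure]
    {f : E → ℝ} (hf : ContDiff ℝ 1 f) (hc : HasCompactSupport f) (v : E) :
    ∫ x, fderiv ℝ f x v ∂μ = 0 := by
  have hi := integrable_fderiv_apply_of_hasCompactSupport (μ := μ) hf hc v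
  have h := integral_mul_fderiv_eq_neg_fderiv_mul_of_integrable (μ := μ) (𝕜 := ℝ)
    (f := fun _ : E => (1 : ℝ)) (g := f) (v := v) (by simp) (by simpa using hi)
    (by simpa using hf.continuous.integrable_of_hasCompactSupport hc)
    (fun x _ => differentiableAt_const _)
    (fun x _ => (hf.differentiable one_ne_zero).differentiableAt)
  simpa using h

/-- A function of `w` vanishing near `0`, times a `C¹` function `q`, is a compactly supported `C¹`
function in `Ω` when `w` vanishes on `∂Ω`; so its derivatives have zero integral. -/
theorem integral_truncation_mul_eq_zero [FiniteDimensional ℝ E] [μ.IsAddHaarMeasure]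
    {Ω : Set E} (hΩo : IsOpen Ω)
    (hΩb : Bornology.IsBounded Ω) {w q : E → ℝ} (hw : ContDiffOn ℝ 1 w Ω)
    (hwc : ContinuousOn w (closure Ω)) (hw0 : ∀ x ∈ frontier Ω, w x = 0)
    (hq : ContDiffOn ℝ 1 q Ω) {φ : ℝ → ℝ} (hφ : ContDiff ℝ 1 φ) {δ : ℝ} (hδ : 0 < δ)
    (hφ0 : ∀ t, |t| < δ → φ t = 0) (v : E) :
    IntegrableOn
        (fun x => deriv φ (w x) * (fderiv ℝ w x v * q x) + φ (w x) * fderiv ℝ q x v) Ω μ ∧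
      ∫ x in Ω, (deriv φ (w x) * (fderiv ℝ w x v * q x) + φ (w x) * fderiv ℝ q x v) ∂μ = 0 := by
  set K : Set E := closure Ω ∩ w ⁻¹' {t | δ ≤ |t|} with hK
  have hKc : IsCompact K := by
    refine hΩb.isCompact_closure.of_isClosed_subset ?_ Set.inter_subset_left
    exact hwc.preimage_isClosed_of_isClosed isClosed_closure
      (isClosed_le continuous_const continuous_abs)
  have hKΩ : K ⊆ Ω := by
    rintro x ⟨hx, hxw⟩
    by_contra hxΩ
    have h0 := hw0 x (by rw [hΩo.frontier_eq]; exact ⟨hx, hxΩ⟩)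
    simp only [Set.mem_preimage, h0, Set.mem_ofPred_eq, abs_zero] at hxw
    linarith
  set G : E → ℝ := Ω.indicator (fun x => φ (w x) * q x) with hG
  have hGK : ∀ x ∉ K, G x = 0 := by
    intro x hx
    by_cases hxΩ : x ∈ Ω
    · have : |w x| < δ := by
        by_contra h
        exact hx ⟨subset_closure hxΩ, not_lt.1 h⟩
      simp [hG, hxΩ, hφ0 _ this]
    · simp [hG, hxΩ]
  have hGev : ∀ x ∈ Ω, G =ᶠ[𝓝 x] fun x => φ (w x) * q x := fun x hx => by
    filter_upwards [hΩo.mem_nhds hx] with y hy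
    simp [hG, hy]
  have hGev0 : ∀ x ∉ K, G =ᶠ[𝓝 x] fun _ => 0 := fun x hx => by
    filter_upwards [hKc.isClosed.isOpen_compl.mem_nhds hx] with y hy
    exact hGK y hy
  have hGC : ContDiff ℝ 1 G := by
    rw [contDiff_iff_contDiffAt]
    intro x
    by_cases hx : x ∈ Ω
    · refine ContDiffAt.congr_of_eventuallyEq ?_ (hGev x hx)
      exact (hφ.contDiffAt.comp x (hw.contDiffAt (hΩo.mem_nhds hx))).mul
        (hq.contDiffAt (hΩo.mem_nhds hx))
    · exact contDiffAt_const.congr_of_eventuallyEq (hGev0 x fun h => hx (hKΩ h))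
  have hGs : HasCompactSupport G := HasCompactSupport.intro hKc hGK
  have hfd : ∀ x ∈ Ω, fderiv ℝ G x v =
      deriv φ (w x) * (fderiv ℝ w x v * q x) + φ (w x) * fderiv ℝ q x v := by
    intro x hx
    have hwd := ((hw.contDiffAt (hΩo.mem_nhds hx)).differentiableAt one_ne_zero).hasFDerivAt
    have hqd := ((hq.contDiffAt (hΩo.mem_nhds hx)).differentiableAt one_ne_zero).hasFDerivAt
    have hφd := ((hφ.differentiable one_ne_zero) (w x)).hasDerivAt
    have h := ((hφd.comp_hasFDerivAt x hwd).mul hqd).congr_of_eventuallyEq (hGev x hx)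
    rw [h.fderiv]
    simp
    ring
  have hfd0 : ∀ x ∉ Ω, fderiv ℝ G x v = 0 := by
    intro x hx
    rw [(hGev0 x fun h => hx (hKΩ h)).fderiv_eq]
    simp
  constructor
  · exact (integrable_fderiv_apply_of_hasCompactSupport hGC hGs v).integrableOn.congr_fun hfd
      hΩo.measurableSet
  · rw [← setIntegral_congr_fun hΩo.measurableSet hfd,
      setIntegral_eq_integral_of_forall_compl_eq_zero hfd0]
    exact integral_fderiv_apply_eq_zero_of_hasCompactSupport hGC hGs v

end IntegrationByParts

/-- A function that is `C¹` up to the closure of a bounded open set has bounded derivative. -/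
theorem exists_bound_norm_fderiv_of_contDiffOn_closure {E F : Type*} [NormedAddCommGroup E]
    [NormedSpace ℝ E] [ProperSpace E] [NormedAddCommGroup F] [NormedSpace ℝ F] {Ω : Set E}
    (hΩo : IsOpen Ω) (hΩb : Bornology.IsBounded Ω) {f : E → F}
    (hf : ContDiffOn ℝ 1 f (closure Ω)) : ∃ C, ∀ x ∈ Ω, ‖fderiv ℝ f x‖ ≤ C := by
  have key : ∃ C, ∀ x ∈ closure Ω, x ∈ Ω → ‖fderiv ℝ f x‖ ≤ C := by
    refine hΩb.isCompact_closure.induction_on (p := fun s => ∃ C, ∀ x ∈ s, x ∈ Ω →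
      ‖fderiv ℝ f x‖ ≤ C) ⟨0, by simp⟩ ?_ ?_ ?_
    · rintro s t hst ⟨C, hC⟩
      exact ⟨C, fun x hx => hC x (hst hx)⟩
    · rintro s t ⟨C, hC⟩ ⟨D, hD⟩
      refine ⟨max C D, ?_⟩
      rintro x (hx | hx) hxΩ
      · exact (hC x hx hxΩ).trans (le_max_left _ _)
      · exact (hD x hx hxΩ).trans (le_max_right _ _)
    · intro x hx
      have h1 : ContDiffWithinAt ℝ (0 + 1) f (closure Ω) x := by simpa using hf x hx
      obtain ⟨t, ht, -, -, f', hf', hf'c⟩ :=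
        (contDiffWithinAt_succ_iff_hasFDerivWithinAt' (by simp)).1 h1
      rw [Set.insert_eq_of_mem hx] at ht
      have hb := hf'c.continuousWithinAt.norm.eventually (gt_mem_nhds (lt_add_one ‖f' x‖))
      refine ⟨_, inter_mem ht hb, ‖f' x‖ + 1, ?_⟩
      rintro y ⟨hyt, hy⟩ hyΩ
      have := (hf' y hyt).hasFDerivAt
        (mem_of_superset (hΩo.mem_nhds hyΩ) subset_closure)
      rw [this.fderiv]
      exact le_of_lt hy
  obtain ⟨C, hC⟩ := key
  exact ⟨C, fun x hx => hC x (subset_closure hx) hx⟩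

theorem contDiffOn_fderiv_apply {E F : Type*} [NormedAddCommGroup E]
    [NormedSpace ℝ E] [NormedAddCommGroup F] [NormedSpace ℝ F] {Ω : Set E}
    (hΩo : IsOpen Ω) {f : E → F} (hf : ContDiffOn ℝ 2 f Ω) (v : E) :
    ContDiffOn ℝ 1 (fun x => fderiv ℝ f x v) Ω :=
  (hf.fderiv_of_isOpen hΩo (by norm_num [one_add_one_eq_two])).clm_apply contDiffOn_const

section Plane

variable {Ω : Set Pt} {w : Pt → ℝ}

theorem continuousOn_gradSqR (hΩo : IsOpen Ω) (hw : ContDiffOn ℝ 2 w Ω) :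
    ContinuousOn (gradSqR w) Ω :=
  continuousOn_finsetSum _ fun _ _ => (contDiffOn_fderiv_apply hΩo hw _).continuousOn.pow 2

theorem continuousOn_lapR (hΩo : IsOpen Ω) (hw : ContDiffOn ℝ 2 w Ω) :
    ContinuousOn (lapR w) Ω :=
  continuousOn_finsetSum _ fun _ _ =>
    ((contDiffOn_fderiv_apply hΩo hw _).continuousOn_fderiv_of_isOpen hΩo le_rfl).clm_apply
      continuousOn_const

theorem gradSqR_nonneg (w : Pt → ℝ) (x : Pt) : 0 ≤ gradSqR w x :=
  Finset.sum_nonneg fun _ _ => sq_nonneg _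

theorem integral_truncation_gradSqR_add_lapR_eq_zero (hΩo : IsOpen Ω)
    (hΩb : Bornology.IsBounded Ω) (hw : ContDiffOn ℝ 2 w Ω)
    (hwc : ContinuousOn w (closure Ω)) (hw0 : ∀ x ∈ frontier Ω, w x = 0)
    {φ : ℝ → ℝ} (hφ : ContDiff ℝ 1 φ) {δ : ℝ} (hδ : 0 < δ) (hφ0 : ∀ t, |t| < δ → φ t = 0) :
    IntegrableOn (fun x => deriv φ (w x) * gradSqR w x + φ (w x) * lapR w x) Ω ∧
      ∫ x in Ω, (deriv φ (w x) * gradSqR w x + φ (w x) * lapR w x) = 0 := by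
  have h := fun i : Fin 2 => integral_truncation_mul_eq_zero (μ := volume) hΩo hΩb
    (hw.of_le one_le_two) hwc hw0
    (contDiffOn_fderiv_apply hΩo hw (EuclideanSpace.single i 1)) hφ hδ hφ0
    (EuclideanSpace.single i 1)
  have hsum : (fun x => deriv φ (w x) * gradSqR w x + φ (w x) * lapR w x) = fun x =>
      ∑ i : Fin 2, (deriv φ (w x) * (fderiv ℝ w x (EuclideanSpace.single i 1) *
        fderiv ℝ w x (EuclideanSpace.single i 1)) + φ (w x) *
        fderiv ℝ (fun y => fderiv ℝ w y (EuclideanSpace.single i 1)) x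
          (EuclideanSpace.single i 1)) := by
    funext x
    simp only [gradSqR, lapR, pdR, Finset.sum_add_distrib, Finset.mul_sum, sq]
  rw [hsum]
  refine ⟨integrable_finsetSum _ fun i _ => (h i).1, ?_⟩
  rw [integral_finsetSum _ fun i _ => (h i).1]
  exact Finset.sum_eq_zero fun i _ => (h i).2

/-- Weak minimum principle, obtained by testing with a truncation of `w`. -/
theorem nonneg_of_lapR_neg_of_neg (hΩo : IsOpen Ω)
    (hΩb : Bornology.IsBounded Ω) (hw : ContDiffOn ℝ 2 w Ω)
    (hwc : ContinuousOn w (closure Ω)) (hw0 : ∀ x ∈ frontier Ω, w x = 0)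
    (hlap : ∀ x ∈ Ω, w x < 0 → lapR w x < 0) : ∀ x ∈ Ω, 0 ≤ w x := by
  intro x₀ hx₀
  by_contra! hneg
  set δ : ℝ := -w x₀ / 2 with hδdef
  have hδ : 0 < δ := by rw [hδdef]; linarith
  set φ : ℝ → ℝ := fun t => -expNegInvGlue (-t - δ) with hφdef
  have hφ : ContDiff ℝ 1 φ :=
    (expNegInvGlue.contDiff.comp (contDiff_id.neg.sub contDiff_const)).neg
  have hφ0 : ∀ t, -δ ≤ t → φ t = 0 := fun t ht => by
    simp only [hφdef, neg_eq_zero, expNegInvGlue.zero_iff_nonpos]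
    linarith
  have hφneg : ∀ t, φ t ≤ 0 := fun t => neg_nonpos.2 (expNegInvGlue.nonneg _)
  have hφmono : Monotone φ := fun s t hst =>
    neg_le_neg (expNegInvGlue.monotone (by linarith))
  have hφx : φ (w x₀) < 0 :=
    neg_lt_zero.2 (expNegInvGlue.pos_of_pos (by rw [hδdef]; linarith))
  obtain ⟨hint, hzero⟩ := integral_truncation_gradSqR_add_lapR_eq_zero hΩo hΩb hw hwc hw0 hφ hδ
    (fun t ht => hφ0 t (abs_lt.1 ht).1.le)
  have h1 : ∀ x, 0 ≤ deriv φ (w x) * gradSqR w x := fun x =>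
    mul_nonneg hφmono.deriv_nonneg (gradSqR_nonneg w x)
  have h2 : ∀ x ∈ Ω, 0 ≤ φ (w x) * lapR w x := by
    intro x hx
    rcases le_or_gt (-δ) (w x) with h | h
    · simp [hφ0 _ h]
    · exact mul_nonneg_of_nonpos_of_nonpos (hφneg _) (hlap x hx (by linarith)).le
  rw [setIntegral_eq_zero_iff_of_nonneg_ae
    ((ae_restrict_mem hΩo.measurableSet).mono fun x hx => add_nonneg (h1 x) (h2 x hx)) hint] at hzero
  have hcw : ContinuousOn w Ω := hwc.mono subset_closure
  have heq := Measure.eqOn_open_of_ae_eq hzero hΩo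
    ((((hφ.continuous_deriv le_rfl).comp_continuousOn hcw).mul (continuousOn_gradSqR hΩo hw)).add
      ((hφ.continuous.comp_continuousOn hcw).mul (continuousOn_lapR hΩo hw)))
    continuousOn_const hx₀
  have h3 := mul_pos_of_neg_of_neg hφx (hlap x₀ hx₀ hneg)
  have h4 := h1 x₀
  simp only [Pi.zero_apply] at heq
  linarith

/-- The smooth cutoff `s ↦ s σ(s - 1)`, which vanishes for `s ≤ 1` and is the identity for
`2 ≤ s`. -/
def smoothCutoff (s : ℝ) : ℝ := s * Real.smoothTransition (s - 1)

theorem contDiff_smoothCutoff : ContDiff ℝ 1 smoothCutoff :=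
  contDiff_id.mul (Real.smoothTransition.contDiff.comp (contDiff_id.sub contDiff_const))

theorem smoothCutoff_of_le_one {s : ℝ} (hs : s ≤ 1) : smoothCutoff s = 0 := by
  rw [smoothCutoff, Real.smoothTransition.zero_of_nonpos (by linarith), mul_zero]

theorem smoothCutoff_of_two_le {s : ℝ} (hs : 2 ≤ s) : smoothCutoff s = s := by
  rw [smoothCutoff, Real.smoothTransition.one_of_one_le (by linarith), mul_one]

theorem abs_smoothCutoff_le (s : ℝ) : |smoothCutoff s| ≤ |s| := by
  rw [smoothCutoff, abs_mul, abs_of_nonneg (Real.smoothTransition.nonneg _)]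
  exact mul_le_of_le_one_right (abs_nonneg _) (Real.smoothTransition.le_one _)

theorem deriv_smoothCutoff_of_lt_one {s : ℝ} (hs : s < 1) : deriv smoothCutoff s = 0 := by
  have h : smoothCutoff =ᶠ[𝓝 s] fun _ => 0 := by
    filter_upwards [gt_mem_nhds hs] with t ht using smoothCutoff_of_le_one (le_of_lt ht)
  simpa using h.deriv_eq

theorem deriv_smoothCutoff_of_two_lt {s : ℝ} (hs : 2 < s) : deriv smoothCutoff s = 1 := by
  have h : smoothCutoff =ᶠ[𝓝 s] id := by
    filter_upwards [lt_mem_nhds hs] with t ht using smoothCutoff_of_two_le (le_of_lt ht)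
  simpa using h.deriv_eq

theorem exists_bound_deriv_smoothCutoff : ∃ C, ∀ s, |deriv smoothCutoff s| ≤ C := by
  obtain ⟨C, hC⟩ := (isCompact_Icc (a := (1 : ℝ)) (b := 2)).exists_bound_of_continuousOn
    (contDiff_smoothCutoff.continuous_deriv le_rfl).continuousOn
  refine ⟨max C 1, fun s => ?_⟩
  rcases lt_or_ge s 1 with h | h
  · simp [deriv_smoothCutoff_of_lt_one h]
  rcases lt_or_ge 2 s with h' | h'
  · simp [deriv_smoothCutoff_of_two_lt h']
  · exact (hC s ⟨h, h'⟩).trans (le_max_left _ _)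

/-- Green's identity `∫ |∇w|² + w Δw = 0` on an arbitrary bounded open set, for a nonnegative
function vanishing on the boundary. -/
theorem integral_gradSqR_add_mul_lapR_eq_zero (hΩo : IsOpen Ω)
    (hΩb : Bornology.IsBounded Ω) (hw : ContDiffOn ℝ 2 w Ω)
    (hwc : ContinuousOn w (closure Ω)) (hw0 : ∀ x ∈ frontier Ω, w x = 0)
    (hnonneg : ∀ x ∈ Ω, 0 ≤ w x) (hgrad : IntegrableOn (gradSqR w) Ω)
    (hlap : IntegrableOn (fun x => w x * lapR w x) Ω) :
    ∫ x in Ω, (gradSqR w x + w x * lapR w x) = 0 := by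
  obtain ⟨C, hC⟩ := exists_bound_deriv_smoothCutoff
  set φ : ℕ → ℝ → ℝ := fun n t => ((n : ℝ) + 1)⁻¹ * smoothCutoff (((n : ℝ) + 1) * t) with hφdef
  have hpos : ∀ n : ℕ, 0 < (n : ℝ) + 1 := fun n => by positivity
  have hφ : ∀ n, ContDiff ℝ 1 (φ n) := fun n =>
    contDiff_const.mul (contDiff_smoothCutoff.comp (contDiff_const.mul contDiff_id))
  have hφ' : ∀ n t, deriv (φ n) t = deriv smoothCutoff (((n : ℝ) + 1) * t) := fun n t => by
    have h1 : HasDerivAt (fun t : ℝ => ((n : ℝ) + 1) * t) ((n : ℝ) + 1) t := by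
      simpa using (hasDerivAt_id t).const_mul ((n : ℝ) + 1)
    have h2 := ((contDiff_smoothCutoff.differentiable one_ne_zero)
      (((n : ℝ) + 1) * t)).hasDerivAt
    have h3 := (h2.comp t h1).const_mul ((n : ℝ) + 1)⁻¹
    refine h3.deriv.trans ?_
    have := (hpos n).ne'
    field_simp
  have hφ0 : ∀ (n : ℕ) t, |t| < ((n : ℝ) + 1)⁻¹ → φ n t = 0 := fun n t ht => by
    have : ((n : ℝ) + 1) * t ≤ 1 := by
      have h1 := mul_le_mul_of_nonneg_left ((le_abs_self t).trans ht.le) (hpos n).le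
      rwa [mul_inv_cancel₀ (hpos n).ne'] at h1
    simp only [hφdef, smoothCutoff_of_le_one this, mul_zero]
  have hφle : ∀ n t, |φ n t| ≤ |t| := fun n t => by
    simp only [hφdef, abs_mul, abs_inv, abs_of_pos (hpos n)]
    rw [inv_mul_le_iff₀ (hpos n)]
    refine (abs_smoothCutoff_le _).trans_eq ?_
    rw [abs_mul, abs_of_pos (hpos n)]
  have h := fun n => integral_truncation_gradSqR_add_lapR_eq_zero hΩo hΩb hw hwc hw0 (hφ n)
    (inv_pos.2 (hpos n)) (hφ0 n)
  have hlim : Tendsto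
      (fun n => ∫ x in Ω, (deriv (φ n) (w x) * gradSqR w x + φ n (w x) * lapR w x)) atTop
      (𝓝 (∫ x in Ω, (gradSqR w x + w x * lapR w x))) := by
    refine tendsto_integral_filter_of_dominated_convergence
      (fun x => C * ‖gradSqR w x‖ + ‖w x * lapR w x‖)
      (Eventually.of_forall fun n => (h n).1.aestronglyMeasurable)
      (Eventually.of_forall fun n => Eventually.of_forall fun x => ?_)
      ((hgrad.norm.const_mul C).add hlap.norm) ?_
    · refine (norm_add_le _ _).trans (add_le_add ?_ ?_)
      · rw [norm_mul, hφ']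
        exact mul_le_mul_of_nonneg_right (hC _) (norm_nonneg _)
      · rw [norm_mul, norm_mul (w x)]
        exact mul_le_mul_of_nonneg_right (hφle _ _) (norm_nonneg _)
    · filter_upwards [ae_restrict_mem hΩo.measurableSet] with x hx
      rcases (hnonneg x hx).eq_or_lt with h0 | h0
      · have hmin : IsLocalMin w x := by
          filter_upwards [hΩo.mem_nhds hx] with y hy
          rw [← h0]
          exact hnonneg y hy
        have hg : gradSqR w x = 0 := by simp [gradSqR, pdR, hmin.fderiv_eq_zero]
        have hφz : ∀ n, φ n 0 = 0 := fun n => hφ0 n 0 (by simpa using hpos n)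
        simp [hg, ← h0, hφz]
      · refine tendsto_const_nhds.congr' ?_
        obtain ⟨N, hN⟩ := exists_nat_gt (2 / w x)
        filter_upwards [eventually_ge_atTop N] with n hn
        have hn' : 2 < ((n : ℝ) + 1) * w x := by
          rw [div_lt_iff₀ h0] at hN
          have : (N : ℝ) ≤ n := by exact_mod_cast hn
          nlinarith
        have hφn : φ n (w x) = w x := by
          simp only [hφdef, smoothCutoff_of_two_le hn'.le]
          rw [inv_mul_cancel_left₀ (hpos n).ne']
        rw [hφ', deriv_smoothCutoff_of_two_lt hn', hφn, one_mul]
  exact tendsto_nhds_unique hlim (by simp only [(h _).2]; exact tendsto_const_nhds)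

theorem pdR_one_sub_normSq {u : Pt → ℂ} {x : Pt} (hu : DifferentiableAt ℝ u x) (i : Fin 2) :
    pdR (fun y => 1 - ‖u y‖ ^ 2) x i = -2 * inner ℝ (u x) (pd u x i) := by
  have h := (hu.hasFDerivAt.norm_sq).const_sub 1
  rw [pdR, h.fderiv]
  simp [pd, -Complex.inner]

theorem lapR_one_sub_normSq (hΩo : IsOpen Ω) {u : Pt → ℂ} (hu : ContDiffOn ℝ 2 u Ω) {x : Pt}
    (hx : x ∈ Ω) :
    lapR (fun y => 1 - ‖u y‖ ^ 2) x = -2 * gradSq u x - 2 * inner ℝ (u x) (lap u x) := by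
  have hd : ∀ y ∈ Ω, DifferentiableAt ℝ u y := fun y hy =>
    (hu.contDiffAt (hΩo.mem_nhds hy)).differentiableAt two_ne_zero
  have key : ∀ i : Fin 2, fderiv ℝ (fun y => pdR (fun y => 1 - ‖u y‖ ^ 2) y i) x
      (EuclideanSpace.single i 1) = -2 * ‖pd u x i‖ ^ 2 -
        2 * inner ℝ (u x) (fderiv ℝ (fun y => pd u y i) x (EuclideanSpace.single i 1)) := by
    intro i
    have hev : (fun y => pdR (fun y => 1 - ‖u y‖ ^ 2) y i) =ᶠ[𝓝 x]
        fun y => -2 * inner ℝ (u y) (pd u y i) := by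
      filter_upwards [hΩo.mem_nhds hx] with y hy using pdR_one_sub_normSq (hd y hy) i
    have hp : DifferentiableAt ℝ (fun y => pd u y i) x :=
      ((contDiffOn_fderiv_apply hΩo hu _).contDiffAt (hΩo.mem_nhds hx)).differentiableAt
        one_ne_zero
    have h := ((hd x hx).hasFDerivAt.inner ℝ hp.hasFDerivAt).const_mul (-2)
    rw [hev.fderiv_eq, h.fderiv, ← real_inner_self_eq_norm_sq]
    simp [fderivInnerCLM_apply, pd]
    ring
  simp only [lapR, key, gradSq, lap, Finset.sum_sub_distrib, Finset.mul_sum, inner_sum]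

end Plane

/-- The integral identity (2.?) obtained by multiplying
`−Δ(1 − |u_ε|²) = −(2/ε²)|u_ε|²(1 − |u_ε|²) + 2|∇u_ε|²` by `1 − |u_ε|²` and
integrating by parts over `Ω`. -/
theorem stmt10
    (Ω : Set Pt) (hΩo : IsOpen Ω) (hΩne : Ω.Nonempty) (hΩconn : IsConnected Ω)
    (hΩbdd : Bornology.IsBounded Ω)
    (g : Pt → ℂ) (hg : ∀ x ∈ frontier Ω, ‖g x‖ = 1)
    (u : ℝ → Pt → ℂ)
    (hu1 : ∀ ε > 0, ContDiffOn ℝ 1 (u ε) (closure Ω))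
    (hu2 : ∀ ε > 0, ContDiffOn ℝ 2 (u ε) Ω)
    (hGL : ∀ ε > 0, ∀ x ∈ Ω,
      -(lap (u ε) x) = ((ε ^ 2 : ℝ) : ℂ)⁻¹ * u ε x * ((1 - ‖u ε x‖ ^ 2 : ℝ) : ℂ))
    (hub : ∀ ε > 0, ∀ x ∈ frontier Ω, u ε x = g x) :
    ∀ ε > 0,
      2 * (∫ x in Ω, gradSq (u ε) x * (1 - ‖u ε x‖ ^ 2)) =
        (2 / ε ^ 2) * (∫ x in Ω, ‖u ε x‖ ^ 2 * (1 - ‖u ε x‖ ^ 2) ^ 2) +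
          ∫ x in Ω, gradSqR (fun y => 1 - ‖u ε y‖ ^ 2) x := by
  intro ε hε
  have hu := hu2 ε hε
  have huc : ContinuousOn (u ε) (closure Ω) := (hu1 ε hε).continuousOn
  have hucΩ : ContinuousOn (u ε) Ω := huc.mono subset_closure
  set w : Pt → ℝ := fun y => 1 - ‖u ε y‖ ^ 2 with hwdef
  have hw : ContDiffOn ℝ 2 w Ω := contDiffOn_const.sub (hu.norm_sq ℝ)
  have hwc : ContinuousOn w (closure Ω) := continuousOn_const.sub (huc.norm.pow 2)
  have hwcΩ : ContinuousOn w Ω := hwc.mono subset_closure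
  have hw0 : ∀ x ∈ frontier Ω, w x = 0 := fun x hx => by
    simp [hwdef, hub ε hε x hx, hg x hx]
  have hlapw : ∀ x ∈ Ω, lapR w x =
      2 / ε ^ 2 * (‖u ε x‖ ^ 2 * w x) - 2 * gradSq (u ε) x := by
    intro x hx
    have hl : lap (u ε) x = (-((ε ^ 2)⁻¹ * w x) : ℝ) • u ε x := by
      rw [← neg_neg (lap (u ε) x), hGL ε hε x hx, Complex.real_smul]
      push_cast [hwdef]
      ring
    rw [lapR_one_sub_normSq hΩo hu hx, hl, real_inner_smul_right, real_inner_self_eq_norm_sq]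
    ring
  have hgs : ∀ x, 0 ≤ gradSq (u ε) x := fun x => Finset.sum_nonneg fun _ _ => sq_nonneg _
  have hnonneg : ∀ x ∈ Ω, 0 ≤ w x := by
    refine nonneg_of_lapR_neg_of_neg hΩo hΩbdd hw hwc hw0 fun x hx hxw => ?_
    have h1 : 0 < ‖u ε x‖ ^ 2 := by simp only [hwdef] at hxw; linarith
    have h2 : 2 / ε ^ 2 * (‖u ε x‖ ^ 2 * w x) < 0 :=
      mul_neg_of_pos_of_neg (by positivity) (mul_neg_of_pos_of_neg h1 hxw)
    rw [hlapw x hx]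
    linarith [hgs x]
  have hule : ∀ x ∈ Ω, ‖u ε x‖ ^ 2 ≤ 1 := fun x hx => by
    have := hnonneg x hx
    simp only [hwdef] at this
    linarith
  have hwle : ∀ x, w x ≤ 1 := fun x => by simp only [hwdef]; nlinarith [norm_nonneg (u ε x)]
  obtain ⟨C, hC⟩ := exists_bound_norm_fderiv_of_contDiffOn_closure hΩo hΩbdd (hu1 ε hε)
  have hpd : ∀ x ∈ Ω, ∀ i, ‖pd (u ε) x i‖ ≤ C := fun x hx i => by
    have := (fderiv ℝ (u ε) x).le_opNorm (EuclideanSpace.single i 1)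
    rw [PiLp.norm_single, norm_one, mul_one] at this
    exact this.trans (hC x hx)
  have hgsle : ∀ x ∈ Ω, gradSq (u ε) x ≤ ∑ _i : Fin 2, C ^ 2 := fun x hx =>
    Finset.sum_le_sum fun i _ => pow_le_pow_left₀ (norm_nonneg _) (hpd x hx i) 2
  have hgwle : ∀ x ∈ Ω, gradSqR w x ≤ ∑ _i : Fin 2, (2 * C) ^ 2 := fun x hx => by
    refine Finset.sum_le_sum fun i _ => ?_
    rw [pdR_one_sub_normSq ((hu.contDiffAt (hΩo.mem_nhds hx)).differentiableAt two_ne_zero)]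
    have h1 := abs_real_inner_le_norm (u ε x) (pd (u ε) x i)
    have h2 : ‖u ε x‖ * ‖pd (u ε) x i‖ ≤ 1 * C :=
      mul_le_mul ((sq_le_one_iff₀ (norm_nonneg _)).1 (hule x hx)) (hpd x hx i) (norm_nonneg _)
        zero_le_one
    refine sq_le_sq' ?_ ?_ <;> linarith [abs_le.1 (h1.trans h2)]
  have hgsc : ContinuousOn (gradSq (u ε)) Ω := continuousOn_finsetSum _ fun _ _ =>
    (contDiffOn_fderiv_apply hΩo hu _).continuousOn.norm.pow 2
  have hint : ∀ (f : Pt → ℝ) (M : ℝ), ContinuousOn f Ω → (∀ x ∈ Ω, 0 ≤ f x) →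
      (∀ x ∈ Ω, f x ≤ M) → IntegrableOn f Ω := fun f M hf hf0 hfM =>
    IntegrableOn.of_bound hΩbdd.measure_lt_top (hf.aestronglyMeasurable hΩo.measurableSet) M
      ((ae_restrict_mem hΩo.measurableSet).mono fun x hx => by
        rw [Real.norm_of_nonneg (hf0 x hx)]
        exact hfM x hx)
  have hA : IntegrableOn (fun x => gradSq (u ε) x * w x) Ω :=
    hint _ ((∑ _i : Fin 2, C ^ 2) * 1) (hgsc.mul hwcΩ)
      (fun x hx => mul_nonneg (hgs x) (hnonneg x hx))
      fun x hx => mul_le_mul (hgsle x hx) (hwle x) (hnonneg x hx) (by positivity)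
  have hB : IntegrableOn (fun x => ‖u ε x‖ ^ 2 * w x ^ 2) Ω :=
    hint _ (1 * 1) ((hucΩ.norm.pow 2).mul (hwcΩ.pow 2)) (fun x _ => by positivity)
      fun x hx => mul_le_mul (hule x hx) (pow_le_one₀ (hnonneg x hx) (hwle x)) (sq_nonneg _)
        zero_le_one
  have hD : IntegrableOn (gradSqR w) Ω :=
    hint _ _ (continuousOn_gradSqR hΩo hw) (fun x _ => gradSqR_nonneg w x) hgwle
  have hsplit : ∀ x ∈ Ω, w x * lapR w x =
      2 / ε ^ 2 * (‖u ε x‖ ^ 2 * w x ^ 2) - 2 * (gradSq (u ε) x * w x) := fun x hx => by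
    rw [hlapw x hx]
    ring
  have hwl : IntegrableOn (fun x => w x * lapR w x) Ω :=
    IntegrableOn.congr_fun ((hB.const_mul (2 / ε ^ 2)).sub (hA.const_mul 2))
      (fun x hx => (hsplit x hx).symm) hΩo.measurableSet
  have hmain := integral_gradSqR_add_mul_lapR_eq_zero hΩo hΩbdd hw hwc hw0 hnonneg hD hwl
  rw [integral_add hD hwl, setIntegral_congr_fun hΩo.measurableSet hsplit,
    integral_sub (hB.const_mul (2 / ε ^ 2)) (hA.const_mul 2), integral_const_mul,
    integral_const_mul] at hmain
  change 2 * (∫ x in Ω, gradSq (u ε) x * w x) =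
    2 / ε ^ 2 * (∫ x in Ω, ‖u ε x‖ ^ 2 * w x ^ 2) + ∫ x in Ω, gradSqR w x
  linarith
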